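/- Let f ≥ 0 and n be integers with n ≤ 2f + 3, and let λ be a bipartition of n. Then, for the counts attached to the f-shifted path sequence of λ, one has b_r + c_r = a_l + d_l + a_m + d_m. -/

import Mathlib

/-- A partition: a non-increasing sequence of non-negative integers with finite sum.
Here `part i` is the `(i+1)`-st part `λ_{i+1}`. -/
structure PartitionSeq : Type where
  part : ℕ → ℕ
  antitone' : ∀ {i j : ℕ}, i ≤ j → part j ≤ part i
  eventually_zero : ∃ N : ℕ, ∀ i : ℕ, N ≤ i → part i = 0

/-- The size `|λ| = Σ_i λ_i` of a partition. -/
noncomputable def PartitionSeq.size (μ : PartitionSeq) : ℕ := ∑ᶠ i : ℕ, μ.part i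

open scoped Classical in
/-- The path sequence (Maya diagram) of a partition: `p_λ(i) = 0` if
`i = λ_j - j + 1` for some `j ≥ 1` (i.e. `i = part j - j` for some `j : ℕ` in the
0-indexed convention used here), and `p_λ(i) = 1` otherwise. -/
noncomputable def PartitionSeq.path (μ : PartitionSeq) (i : ℤ) : ℕ :=
  if ∃ j : ℕ, i = (μ.part j : ℤ) - (j : ℤ) then 0 else 1

section PathCounts

variable (μ₁ μ₂ : PartitionSeq) (f : ℕ)

/-- Predicate: position `i` of the `f`-shifted path sequence of the bipartition
`(μ₁, μ₂)` carries the pair `A = (0,1)`. -/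
def pairA (i : ℤ) : Prop := μ₁.path i = 0 ∧ μ₂.path (i - f) = 1

/-- Pair `B = (1,0)` at position `i`. -/
def pairB (i : ℤ) : Prop := μ₁.path i = 1 ∧ μ₂.path (i - f) = 0

/-- Pair `C = (0,0)` at position `i`. -/
def pairC (i : ℤ) : Prop := μ₁.path i = 0 ∧ μ₂.path (i - f) = 0

/-- Pair `D = (1,1)` at position `i`. -/
def pairD (i : ℤ) : Prop := μ₁.path i = 1 ∧ μ₂.path (i - f) = 1

/-- The number of positions `i ≤ 0` (the left region) where `P` holds. -/
noncomputable def countL (P : ℤ → Prop) : ℕ := Set.ncard {i : ℤ | i ≤ 0 ∧ P i}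

/-- The number of positions `1 ≤ i ≤ f` (the middle region) where `P` holds. -/
noncomputable def countM (P : ℤ → Prop) : ℕ :=
  Set.ncard {i : ℤ | 1 ≤ i ∧ i ≤ (f : ℤ) ∧ P i}

/-- The number of positions `i > f` (the right region) where `P` holds. -/
noncomputable def countR (P : ℤ → Prop) : ℕ := Set.ncard {i : ℤ | (f : ℤ) < i ∧ P i}

end PathCounts

namespace PartitionSeq

variable (μ : PartitionSeq)

theorem path_eq_zero_iff (i : ℤ) :
    μ.path i = 0 ↔ ∃ j : ℕ, i = (μ.part j : ℤ) - (j : ℤ) := by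
  simp [path]

theorem path_eq_one_iff (i : ℤ) : μ.path i = 1 ↔ ¬ μ.path i = 0 := by
  unfold path
  split_ifs <;> simp

theorem strictAnti_part_sub : StrictAnti fun j : ℕ => (μ.part j : ℤ) - (j : ℤ) := by
  intro i j hij
  have := μ.antitone' hij.le
  dsimp only
  omega

/-- Beyond some depth the path sequence is determined by finitely many parts: its zeros at
positive positions and its ones at non-positive positions are the two differences of a pair of
finite sets of equal size. -/
theorem exists_finset_path : ∃ s t : Finset ℤ, s.card = t.card ∧
    {i : ℤ | 0 < i ∧ μ.path i = 0} = ↑(s \ t) ∧ {i : ℤ | i ≤ 0 ∧ μ.path i = 1} = ↑(t \ s) := by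
  obtain ⟨N, hN⟩ := μ.eventually_zero
  refine ⟨(Finset.range N).image fun j : ℕ => (μ.part j : ℤ) - (j : ℤ),
    Finset.Ioc (-(N : ℤ)) 0, ?_, ?_, ?_⟩
  · rw [Finset.card_image_of_injective _ μ.strictAnti_part_sub.injective]
    simp
  · ext i
    simp only [Set.mem_ofPred_eq, path_eq_zero_iff, Finset.coe_sdiff, Set.mem_sdiff, Finset.mem_coe,
      Finset.mem_image, Finset.mem_range, Finset.mem_Ioc]
    constructor
    · rintro ⟨hi, j, rfl⟩
      refine ⟨⟨j, ?_, rfl⟩, by omega⟩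
      by_contra! hj
      have := hN j hj
      omega
    · rintro ⟨⟨j, hj, rfl⟩, h⟩
      exact ⟨by omega, j, rfl⟩
  · ext i
    simp only [Set.mem_ofPred_eq, path_eq_one_iff, path_eq_zero_iff, Finset.coe_sdiff, Set.mem_sdiff,
      Finset.mem_coe, Finset.mem_image, Finset.mem_range, Finset.mem_Ioc]
    constructor
    · rintro ⟨hi, h⟩
      refine ⟨⟨?_, hi⟩, fun ⟨j, _, hj⟩ => h ⟨j, hj.symm⟩⟩
      by_contra! hlt
      refine h ⟨i.natAbs, ?_⟩
      have := hN i.natAbs (by omega)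
      omega
    · rintro ⟨⟨hlt, hi⟩, h⟩
      refine ⟨hi, ?_⟩
      rintro ⟨j, rfl⟩
      refine h ⟨j, ?_, rfl⟩
      by_contra! hj
      have := hN j hj
      omega

theorem finite_pos_path_eq_zero : {i : ℤ | 0 < i ∧ μ.path i = 0}.Finite := by
  obtain ⟨s, t, -, h, -⟩ := μ.exists_finset_path
  exact h ▸ Finset.finite_toSet _

theorem finite_nonpos_path_eq_one : {i : ℤ | i ≤ 0 ∧ μ.path i = 1}.Finite := by
  obtain ⟨s, t, -, -, h⟩ := μ.exists_finset_path
  exact h ▸ Finset.finite_toSet _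

/-- The path sequence of a partition has charge zero. -/
theorem ncard_pos_path_eq_zero :
    {i : ℤ | 0 < i ∧ μ.path i = 0}.ncard = {i : ℤ | i ≤ 0 ∧ μ.path i = 1}.ncard := by
  obtain ⟨s, t, hst, h₀, h₁⟩ := μ.exists_finset_path
  rw [h₀, h₁, Set.ncard_coe_finset, Set.ncard_coe_finset, Finset.card_sdiff_comm hst]

end PartitionSeq

theorem Set.ncard_sep_add_ncard_sep_not {α : Type*} {s : Set α} (hs : s.Finite) (p : α → Prop) :
    {x ∈ s | p x}.ncard + {x ∈ s | ¬ p x}.ncard = s.ncard :=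
  Set.ncard_inter_add_ncard_sdiff_eq_ncard s {x | p x} hs

theorem setOf_sub_mem_eq_image (s : Set ℤ) (a : ℤ) : {i | i - a ∈ s} = (· + a) '' s := by
  ext i
  simp [sub_eq_add_neg]

theorem ncard_setOf_sub_mem (s : Set ℤ) (a : ℤ) : {i | i - a ∈ s}.ncard = s.ncard := by
  rw [setOf_sub_mem_eq_image, Set.ncard_image_of_injective _ (add_left_injective a)]

theorem finite_setOf_sub_mem {s : Set ℤ} (hs : s.Finite) (a : ℤ) : {i | i - a ∈ s}.Finite := by
  rw [setOf_sub_mem_eq_image]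
  exact hs.image _

theorem countR_pairB_add_countR_pairC (f : ℕ) (μ₁ μ₂ : PartitionSeq) :
    countR f (pairB μ₁ μ₂ f) + countR f (pairC μ₁ μ₂ f) =
      {i : ℤ | 0 < i ∧ μ₂.path i = 0}.ncard := by
  rw [← ncard_setOf_sub_mem _ (f : ℤ), ← Set.ncard_sep_add_ncard_sep_not
    (finite_setOf_sub_mem μ₂.finite_pos_path_eq_zero f) fun i => μ₁.path i = 1]
  unfold countR pairB pairC
  congr 2 <;> ext i <;> simp only [Set.mem_ofPred_eq, PartitionSeq.path_eq_one_iff] <;> grind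

theorem countL_add_countM_pairA_pairD (f : ℕ) (μ₁ μ₂ : PartitionSeq) :
    countL (pairA μ₁ μ₂ f) + countL (pairD μ₁ μ₂ f) +
      countM f (pairA μ₁ μ₂ f) + countM f (pairD μ₁ μ₂ f) =
      {i : ℤ | i ≤ 0 ∧ μ₂.path i = 1}.ncard := by
  have hfin := finite_setOf_sub_mem μ₂.finite_nonpos_path_eq_one f
  rw [← ncard_setOf_sub_mem _ (f : ℤ), ← Set.ncard_sep_add_ncard_sep_not hfin fun i => i ≤ 0,
    ← Set.ncard_sep_add_ncard_sep_not (hfin.sep fun i => i ≤ 0) fun i => μ₁.path i = 0,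
    ← Set.ncard_sep_add_ncard_sep_not (hfin.sep fun i => ¬ i ≤ 0) fun i => μ₁.path i = 0,
    ← add_assoc]
  unfold countL countM pairA pairD
  congr 2
  · congr 2 <;> ext i <;> simp only [Set.mem_ofPred_eq, PartitionSeq.path_eq_one_iff] <;> grind
  · congr 1
    ext i
    simp only [Set.mem_ofPred_eq, PartitionSeq.path_eq_one_iff]
    grind
  · ext i
    simp only [Set.mem_ofPred_eq, PartitionSeq.path_eq_one_iff]
    grind

theorem path_counts_right_eq
    (f n : ℕ) (hn : n ≤ 2 * f + 3) (μ₁ μ₂ : PartitionSeq)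
    (hsize : μ₁.size + μ₂.size = n) :
    countR f (pairB μ₁ μ₂ f) + countR f (pairC μ₁ μ₂ f) =
      countL (pairA μ₁ μ₂ f) + countL (pairD μ₁ μ₂ f) +
        countM f (pairA μ₁ μ₂ f) + countM f (pairD μ₁ μ₂ f) := by
  rw [countR_pairB_add_countR_pairC, countL_add_countM_pairA_pairD, μ₂.ncard_pos_path_eq_zero]
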